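/- Let A be a 4×5 (−1,1)-matrix of rank 4 over ℚ. Then mper A ≤ mper D_{(5,4,3)} (= 32), and equality holds if and only if A can be obtained from D_{(5,4,3)} by permutations of rows and columns and multiplications of rows or columns by −1. -/

import Mathlib

open Matrix

/-- The permanent of a square matrix. -/
def per {n : ℕ} (A : Matrix (Fin n) (Fin n) ℚ) : ℚ :=
  ∑ σ : Equiv.Perm (Fin n), ∏ i, A i (σ i)

/-- The rectangular matrix `D_{(n,k,l)}` (`k` rows, `n` columns): `-1` on the first `l`
diagonal entries, `1` elsewhere. -/
def Dr (n k l : ℕ) : Matrix (Fin k) (Fin n) ℚ :=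
  fun i j => if (i : ℕ) = (j : ℕ) ∧ (j : ℕ) < l then -1 else 1

/-- `A` is obtained from `B` by permutations of rows and columns and multiplications of
rows or columns by `-1` (rectangular case, no transposition). -/
def RectEquiv {k n : ℕ} (A B : Matrix (Fin k) (Fin n) ℚ) : Prop :=
  ∃ (ρ : Equiv.Perm (Fin k)) (σ : Equiv.Perm (Fin n)) (ε : Fin k → ℚ) (δ : Fin n → ℚ),
    (∀ i, ε i = 1 ∨ ε i = -1) ∧ (∀ j, δ j = 1 ∨ δ j = -1) ∧
    ∀ i j, A i j = ε i * δ j * B (ρ i) (σ j)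

/-- `mper A`: the sum of `|per B|` over all `k × k` submatrices `B` of a `k × n` matrix `A`
obtained by choosing `k` of the `n` columns (keeping their order). -/
def mper {k n : ℕ} (A : Matrix (Fin k) (Fin n) ℚ) : ℚ :=
  ∑ s ∈ (Finset.powersetCard k (Finset.univ : Finset (Fin n))).attach,
    |per (A.submatrix id (s.1.orderEmbOfFin (Finset.mem_powersetCard.mp s.2).2))|

theorem per_eq_permanent {n : ℕ} (A : Matrix (Fin n) (Fin n) ℚ) : per A = A.permanent := by
  rw [← permanent_transpose]; rfl

theorem per_submatrix_eq_of_range_subset {k n : ℕ} (A : Matrix (Fin k) (Fin n) ℚ)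
    {f g : Fin k → Fin n} (hg : g.Injective) (h : Set.range g ⊆ Set.range f) :
    per (A.submatrix id g) = per (A.submatrix id f) := by
  choose τ hτ using fun i => h ⟨i, rfl⟩
  have hinj : τ.Injective := fun a b hab => hg (by rw [← hτ a, ← hτ b, hab])
  have := permanent_permute_rows (Equiv.ofBijective τ (Finite.injective_iff_bijective.mp hinj))
    (A.submatrix id f)
  rw [per_eq_permanent, per_eq_permanent, ← this]
  congr 1
  ext i j
  simp [hτ]

/-- Each summand of `mper` may be computed with any enumeration of the chosen columns. -/
theorem exists_mper_eq_sum {k n : ℕ} (A : Matrix (Fin k) (Fin n) ℚ) :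
    ∃ G : Finset (Fin n) → ℚ, mper A = ∑ s ∈ Finset.powersetCard k Finset.univ, G s ∧
      ∀ f : Fin k ↪ Fin n, G (Finset.univ.map f) = |per (A.submatrix id f)| := by
  refine ⟨fun s => if h : s.card = k then |per (A.submatrix id (s.orderEmbOfFin h))| else 0,
    ?_, fun f => ?_⟩
  · rw [← Finset.sum_attach]
    refine Finset.sum_congr rfl fun s _ => ?_
    rw [dif_pos (Finset.mem_powersetCard.mp s.2).2]
  · refine (dif_pos (by simp)).trans (congrArg abs ?_)
    refine per_submatrix_eq_of_range_subset A (RelEmbedding.injective _) ?_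
    simp

theorem per_scale {k : ℕ} (M : Matrix (Fin k) (Fin k) ℚ) (ε δ : Fin k → ℚ)
    (ρ : Equiv.Perm (Fin k)) :
    per (fun i j => ε i * δ j * M (ρ i) j) = (∏ i, ε i) * (∏ j, δ j) * per M := by
  have h : per (M.submatrix ρ id) = per M := by
    rw [per_eq_permanent, per_eq_permanent, permanent_permute_cols]
  rw [← h]
  simp only [per, Finset.mul_sum]
  refine Finset.sum_congr rfl fun σ _ => ?_
  rw [← Equiv.prod_comp σ δ]
  simp [Finset.prod_mul_distrib]

theorem abs_prod_eq_one {k : ℕ} {ε : Fin k → ℚ} (h : ∀ i, ε i = 1 ∨ ε i = -1) :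
    |∏ i, ε i| = 1 := by
  rw [Finset.abs_prod]
  exact Finset.prod_eq_one fun i _ => by rcases h i with h | h <;> simp [h]

theorem RectEquiv.mper_eq {k n : ℕ} {A B : Matrix (Fin k) (Fin n) ℚ} (h : RectEquiv A B) :
    mper A = mper B := by
  obtain ⟨ρ, σ, ε, δ, hε, hδ, h⟩ := h
  obtain ⟨G, hG, hGf⟩ := exists_mper_eq_sum A
  obtain ⟨H, hH, hHf⟩ := exists_mper_eq_sum B
  rw [hG, hH]
  refine Finset.sum_equiv (Equiv.finsetCongr σ) (by simp) fun s hs => ?_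
  obtain ⟨f, rfl⟩ : ∃ f : Fin k ↪ Fin n, Finset.univ.map f = s :=
    ⟨(s.orderEmbOfFin (Finset.mem_powersetCard.mp hs).2).toEmbedding, by simp⟩
  have hmap : Equiv.finsetCongr σ (Finset.univ.map f) =
      Finset.univ.map (f.trans σ.toEmbedding) := by simp [Finset.map_map]
  rw [hmap, hGf, hHf]
  have hsub : A.submatrix id f = fun i j => ε i * δ (f j) *
      B.submatrix id (f.trans σ.toEmbedding) (ρ i) j := by
    ext i j; simp [h]
  rw [hsub, per_scale _ ε (fun j => δ (f j)), abs_mul, abs_mul, abs_prod_eq_one hε,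
    abs_prod_eq_one fun j => hδ (f j), one_mul, one_mul]

theorem RectEquiv.trans {k n : ℕ} {A B C : Matrix (Fin k) (Fin n) ℚ} (hAB : RectEquiv A B)
    (hBC : RectEquiv B C) : RectEquiv A C := by
  obtain ⟨ρ, σ, ε, δ, hε, hδ, h⟩ := hAB
  obtain ⟨ρ', σ', ε', δ', hε', hδ', h'⟩ := hBC
  refine ⟨ρ.trans ρ', σ.trans σ', fun i => ε i * ε' (ρ i), fun j => δ j * δ' (σ j),
    fun i => ?_, fun j => ?_, fun i j => ?_⟩
  · rcases hε i with h | h <;> rcases hε' (ρ i) with h' | h' <;> simp [h, h']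
  · rcases hδ j with h | h <;> rcases hδ' (σ j) with h' | h' <;> simp [h, h']
  · rw [h, h', Equiv.trans_apply, Equiv.trans_apply]; ring

theorem mper_succ {k : ℕ} (A : Matrix (Fin k) (Fin (k + 1)) ℚ) :
    mper A = ∑ j : Fin (k + 1), |per (A.submatrix id j.succAbove)| := by
  obtain ⟨G, hG, hGf⟩ := exists_mper_eq_sum A
  rw [hG]
  symm
  refine Finset.sum_bij (fun j _ => Finset.univ.map (Fin.succAboveEmb j)) (by simp)
    (fun j _ j' _ h => ?_) (fun s hs => ?_) fun j _ => (hGf (Fin.succAboveEmb j)).symm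
  · by_contra hne
    obtain ⟨i, hi⟩ := Fin.exists_succAbove_eq hne
    have : j ∈ Finset.univ.map (Fin.succAboveEmb j) := by rw [h]; simp [← hi]
    simp [Fin.succAbove_ne] at this
  · have hc : sᶜ.card = 1 := by
      rw [Finset.card_compl, (Finset.mem_powersetCard.mp hs).2]; simp
    obtain ⟨j, hj⟩ := Finset.card_eq_one.mp hc
    refine ⟨j, Finset.mem_univ _, ?_⟩
    rw [← compl_compl s, hj]
    ext i
    simp [Fin.exists_succAbove_eq_iff]

theorem per_four (A : Matrix (Fin 4) (Fin 4) ℚ) :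
    per A =
      A 0 0 * (A 1 1 * (A 2 2 * A 3 3 + A 2 3 * A 3 2) + A 1 2 * (A 2 1 * A 3 3 + A 2 3 * A 3 1) +
        A 1 3 * (A 2 1 * A 3 2 + A 2 2 * A 3 1)) +
      A 0 1 * (A 1 0 * (A 2 2 * A 3 3 + A 2 3 * A 3 2) + A 1 2 * (A 2 0 * A 3 3 + A 2 3 * A 3 0) +
        A 1 3 * (A 2 0 * A 3 2 + A 2 2 * A 3 0)) +
      A 0 2 * (A 1 0 * (A 2 1 * A 3 3 + A 2 3 * A 3 1) + A 1 1 * (A 2 0 * A 3 3 + A 2 3 * A 3 0) +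
        A 1 3 * (A 2 0 * A 3 1 + A 2 1 * A 3 0)) +
      A 0 3 * (A 1 0 * (A 2 1 * A 3 2 + A 2 2 * A 3 1) + A 1 1 * (A 2 0 * A 3 2 + A 2 2 * A 3 0) +
        A 1 2 * (A 2 0 * A 3 1 + A 2 1 * A 3 0)) := by
  rw [per]
  simp_rw [← (Equiv.Perm.decomposeFin (n := 3)).symm.sum_comp, Fintype.sum_prod_type,
    ← (Equiv.Perm.decomposeFin (n := 2)).symm.sum_comp, Fintype.sum_prod_type,
    ← (Equiv.Perm.decomposeFin (n := 1)).symm.sum_comp, Fintype.sum_prod_type]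
  simp [Fin.sum_univ_succ, Fin.prod_univ_succ, Equiv.Perm.decomposeFin, Equiv.swap_apply_def,
    Equiv.Perm.decomposeOption]
  ring

theorem mper_Dr : mper (Dr 5 4 3) = 32 := by
  rw [mper_succ]
  simp [Fin.sum_univ_succ, per_four, Dr, Fin.succAbove]
  norm_num

theorem linearIndependent_row_of_rank_eq {k n : ℕ} {A : Matrix (Fin k) (Fin n) ℚ}
    (h : A.rank = k) : LinearIndependent ℚ A.row := by
  rw [linearIndependent_iff_card_eq_finrank_span, Fintype.card_fin, Set.finrank,
    ← rank_eq_finrank_span_row, h]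

theorem RectEquiv.rank_ne_of_row_eq {k n : ℕ} {A B : Matrix (Fin k) (Fin n) ℚ}
    (h : RectEquiv A B) {i i' : Fin k} (hne : i ≠ i') (hB : ∀ j, B i j = B i' j) :
    A.rank ≠ k := by
  intro hrk
  obtain ⟨ρ, σ, ε, δ, hε, -, h⟩ := h
  have hε0 : ∀ i, ε i ≠ 0 := fun i => by rcases hε i with h | h <;> simp [h]
  have hsum := Fintype.linearIndependent_iff.mp (linearIndependent_row_of_rank_eq hrk)
    (Pi.single (ρ.symm i) (ε (ρ.symm i')) - Pi.single (ρ.symm i') (ε (ρ.symm i))) (by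
      simp only [Pi.sub_apply, sub_smul, Finset.sum_sub_distrib, Pi.single_apply, ite_smul,
        zero_smul, Finset.sum_ite_eq', Finset.mem_univ, if_true]
      ext j
      simp [h, hB]
      ring) (ρ.symm i)
  simp [hne, hε0] at hsum

/-- The `4 × 5` matrix with first row and first column equal to `1` and the given other entries. -/
def bordered (x₁ x₂ x₃ x₄ y₁ y₂ y₃ y₄ z₁ z₂ z₃ z₄ : ℤ) : Matrix (Fin 4) (Fin 5) ℤ :=
  !![1, 1, 1, 1, 1;
     1, x₁, x₂, x₃, x₄;
     1, y₁, y₂, y₃, y₄;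
     1, z₁, z₂, z₃, z₄]

/-- The permanent of the `3 × 3` matrix with rows `x`, `y`, `z`. -/
def perThree (x₁ x₂ x₃ y₁ y₂ y₃ z₁ z₂ z₃ : ℤ) : ℤ :=
  x₁ * (y₂ * z₃ + y₃ * z₂) + x₂ * (y₁ * z₃ + y₃ * z₁) + x₃ * (y₁ * z₂ + y₂ * z₁)

/-- An integer formula for `mper` of a `bordered` matrix, by expansion along the first row. -/
def mperBordered (x₁ x₂ x₃ x₄ y₁ y₂ y₃ y₄ z₁ z₂ z₃ z₄ : ℤ) : ℕ :=
  (perThree x₁ x₂ x₃ y₁ y₂ y₃ z₁ z₂ z₃ + perThree x₁ x₂ x₄ y₁ y₂ y₄ z₁ z₂ z₄ +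
    perThree x₁ x₃ x₄ y₁ y₃ y₄ z₁ z₃ z₄ + perThree x₂ x₃ x₄ y₂ y₃ y₄ z₂ z₃ z₄).natAbs +
  (perThree 1 x₂ x₃ 1 y₂ y₃ 1 z₂ z₃ + perThree 1 x₂ x₄ 1 y₂ y₄ 1 z₂ z₄ +
    perThree 1 x₃ x₄ 1 y₃ y₄ 1 z₃ z₄ + perThree x₂ x₃ x₄ y₂ y₃ y₄ z₂ z₃ z₄).natAbs +
  (perThree 1 x₁ x₃ 1 y₁ y₃ 1 z₁ z₃ + perThree 1 x₁ x₄ 1 y₁ y₄ 1 z₁ z₄ +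
    perThree 1 x₃ x₄ 1 y₃ y₄ 1 z₃ z₄ + perThree x₁ x₃ x₄ y₁ y₃ y₄ z₁ z₃ z₄).natAbs +
  (perThree 1 x₁ x₂ 1 y₁ y₂ 1 z₁ z₂ + perThree 1 x₁ x₄ 1 y₁ y₄ 1 z₁ z₄ +
    perThree 1 x₂ x₄ 1 y₂ y₄ 1 z₂ z₄ + perThree x₁ x₂ x₄ y₁ y₂ y₄ z₁ z₂ z₄).natAbs +
  (perThree 1 x₁ x₂ 1 y₁ y₂ 1 z₁ z₂ + perThree 1 x₁ x₃ 1 y₁ y₃ 1 z₁ z₃ +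
    perThree 1 x₂ x₃ 1 y₂ y₃ 1 z₂ z₃ + perThree x₁ x₂ x₃ y₁ y₂ y₃ z₁ z₂ z₃).natAbs

theorem mper_bordered (x₁ x₂ x₃ x₄ y₁ y₂ y₃ y₄ z₁ z₂ z₃ z₄ : ℤ) :
    mper ((bordered x₁ x₂ x₃ x₄ y₁ y₂ y₃ y₄ z₁ z₂ z₃ z₄).map (Int.cast : ℤ → ℚ)) =
      mperBordered x₁ x₂ x₃ x₄ y₁ y₂ y₃ y₄ z₁ z₂ z₃ z₄ := by
  rw [mper_succ, Fin.sum_univ_five, mperBordered]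
  simp only [Nat.cast_add, Nat.cast_natAbs, Int.cast_abs]
  refine congrArg₂ _ (congrArg₂ _ (congrArg₂ _ (congrArg₂ _ ?_ ?_) ?_) ?_) ?_
  all_goals
    refine congrArg abs ?_
    simp [per_four, perThree, bordered, Fin.succAbove]
    ring

/-- Up to sign, column `q` of `A` differs from column `j` in row `p` only. -/
def IsFlip (A : Matrix (Fin 4) (Fin 5) ℤ) (j : Fin 5) (p : Fin 4) (q : Fin 5) : Prop :=
  ∀ i, A i q = A p q * A p j * A i j * if i = p then 1 else -1

instance (A : Matrix (Fin 4) (Fin 5) ℤ) (j : Fin 5) (p : Fin 4) (q : Fin 5) :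
    Decidable (IsFlip A j p q) := by
  unfold IsFlip; infer_instance

/-- Up to sign, two columns of `A` agree and the others differ from these in three distinct
single rows. This is how `Dr 5 4 3` looks. -/
def HasFlipPattern (A : Matrix (Fin 4) (Fin 5) ℤ) : Prop :=
  ∃ j₃ j₄, j₃ ≠ j₄ ∧ (∀ i, A i j₄ = A 0 j₃ * A 0 j₄ * A i j₃) ∧
    ∃ q₀ p₀, q₀ ≠ j₃ ∧ q₀ ≠ j₄ ∧ IsFlip A j₃ p₀ q₀ ∧
    ∃ q₁ p₁, q₁ ≠ j₃ ∧ q₁ ≠ j₄ ∧ q₁ ≠ q₀ ∧ p₁ ≠ p₀ ∧ IsFlip A j₃ p₁ q₁ ∧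
    ∃ q₂ p₂, q₂ ≠ j₃ ∧ q₂ ≠ j₄ ∧ q₂ ≠ q₀ ∧ q₂ ≠ q₁ ∧ p₂ ≠ p₀ ∧ p₂ ≠ p₁ ∧ IsFlip A j₃ p₂ q₂

set_option synthInstance.maxSize 4096 in
set_option synthInstance.maxHeartbeats 400000 in
instance (A : Matrix (Fin 4) (Fin 5) ℤ) : Decidable (HasFlipPattern A) := by
  unfold HasFlipPattern; infer_instance

theorem rectEquiv_Dr_of_isFlip {A : Matrix (Fin 4) (Fin 5) ℤ}
    (hA : ∀ i j, A i j = 1 ∨ A i j = -1) {p : Fin 4 → Fin 4} {q : Fin 5 → Fin 5}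
    (hp : p.Injective) (hq : q.Injective)
    (hj : ∀ i, A i (q 4) = A 0 (q 3) * A 0 (q 4) * A i (q 3)) (hf₀ : IsFlip A (q 3) (p 0) (q 0))
    (hf₁ : IsFlip A (q 3) (p 1) (q 1)) (hf₂ : IsFlip A (q 3) (p 2) (q 2)) :
    RectEquiv (A.map (Int.cast : ℤ → ℚ)) (Dr 5 4 3) := by
  let P := Equiv.ofBijective p (Finite.injective_iff_bijective.mp hp)
  let Q := Equiv.ofBijective q (Finite.injective_iff_bijective.mp hq)
  have hsign : ∀ i j i' j', A i j * A i' j' = 1 ∨ A i j * A i' j' = -1 := by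
    intro i j i' j'
    rcases hA i j with h | h <;> rcases hA i' j' with h' | h' <;> simp [h, h']
  let d : Fin 5 → ℤ := ![-(A (p 0) (q 0) * A (p 0) (q 3)), -(A (p 1) (q 1) * A (p 1) (q 3)),
    -(A (p 2) (q 2) * A (p 2) (q 3)), 1, A 0 (q 3) * A 0 (q 4)]
  have hd : ∀ j, d j = 1 ∨ d j = -1 := by
    have hneg : ∀ {a : ℤ}, a = 1 ∨ a = -1 → -a = 1 ∨ -a = -1 := by
      rintro _ (rfl | rfl) <;> simp
    intro j
    fin_cases j
    exacts [hneg (hsign _ _ _ _), hneg (hsign _ _ _ _), hneg (hsign _ _ _ _), .inl rfl,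
      hsign _ _ _ _]
  refine ⟨P.symm, Q.symm, fun i => (A i (q 3) : ℤ), fun j => (d (Q.symm j) : ℤ), fun i => ?_,
    fun j => ?_, fun i j => ?_⟩
  · rcases hA i (q 3) with h | h <;> simp [h]
  · rcases hd (Q.symm j) with h | h <;> simp [h]
  · obtain ⟨a, rfl⟩ := P.surjective i
    obtain ⟨b, rfl⟩ := Q.surjective j
    simp only [Equiv.symm_apply_apply, map_apply]
    change (A (p a) (q b) : ℚ) = A (p a) (q 3) * d b * Dr 5 4 3 a b
    fin_cases b
    · simp only [Fin.zero_eta, hf₀ (p a), hp.eq_iff]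
      fin_cases a <;> simp [Dr, d] <;> ring
    · simp only [Fin.mk_one, hf₁ (p a), hp.eq_iff]
      fin_cases a <;> simp [Dr, d] <;> ring
    · simp only [Fin.reduceFinMk, hf₂ (p a), hp.eq_iff]
      fin_cases a <;> simp [Dr, d] <;> ring
    · simp [Dr, d]
    · simp [Dr, d, hj (p a)]
      ring

theorem HasFlipPattern.rectEquiv {A : Matrix (Fin 4) (Fin 5) ℤ} (h : HasFlipPattern A)
    (hA : ∀ i j, A i j = 1 ∨ A i j = -1) :
    RectEquiv (A.map (Int.cast : ℤ → ℚ)) (Dr 5 4 3) := by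
  obtain ⟨j₃, j₄, h₃₄, hj, q₀, p₀, h₀₃, h₀₄, hf₀, q₁, p₁, h₁₃, h₁₄, h₁₀, hp₁₀, hf₁,
    q₂, p₂, h₂₃, h₂₄, h₂₀, h₂₁, hp₂₀, hp₂₁, hf₂⟩ := h
  obtain ⟨p₃, hp₃⟩ : ∃ p₃, p₃ ∉ ({p₀, p₁, p₂} : Finset (Fin 4)) :=
    Finset.exists_mem_notMem_of_card_lt_card (s := {p₀, p₁, p₂}) (t := Finset.univ)
      (Finset.card_le_three.trans_lt (by simp)) |>.imp fun _ => And.right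
  refine rectEquiv_Dr_of_isFlip hA (p := ![p₀, p₁, p₂, p₃]) (q := ![q₀, q₁, q₂, j₃, j₄])
    (List.nodup_ofFn.mp ?_) (List.nodup_ofFn.mp ?_) hj hf₀ hf₁ hf₂
  · simp at hp₃
    simp [Ne.symm, *]
  · simp [Ne.symm, *]

/-- The sign encoded by a Boolean. -/
def boolSign (b : Bool) : ℤ := if b then -1 else 1

theorem boolSign_eq (b : Bool) : boolSign b = 1 ∨ boolSign b = -1 := by
  cases b <;> simp [boolSign]

theorem exists_boolSign_eq {a : ℚ} (h : a = 1 ∨ a = -1) : ∃ b, (boolSign b : ℚ) = a := by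
  rcases h with rfl | rfl
  · exact ⟨false, by simp [boolSign]⟩
  · exact ⟨true, by simp [boolSign]⟩

/-- The alternatives for a sign matrix `A` whose `mper` is `m`. -/
def SmallOrExtremal (A : Matrix (Fin 4) (Fin 5) ℤ) (m : ℕ) : Prop :=
  m ≤ 24 ∨ (∃ i i', i ≠ i' ∧ ∀ j, A i j * A i' j = 1) ∨ m = 32 ∧ HasFlipPattern A

instance (A : Matrix (Fin 4) (Fin 5) ℤ) (m : ℕ) : Decidable (SmallOrExtremal A m) := by
  unfold SmallOrExtremal; infer_instance

theorem smallOrExtremal_bordered : ∀ x₁ x₂ x₃ x₄ y₁ y₂ y₃ y₄ z₁ z₂ z₃ z₄,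
    SmallOrExtremal
      (bordered (boolSign x₁) (boolSign x₂) (boolSign x₃) (boolSign x₄)
        (boolSign y₁) (boolSign y₂) (boolSign y₃) (boolSign y₄)
        (boolSign z₁) (boolSign z₂) (boolSign z₃) (boolSign z₄))
      (mperBordered (boolSign x₁) (boolSign x₂) (boolSign x₃) (boolSign x₄)
        (boolSign y₁) (boolSign y₂) (boolSign y₃) (boolSign y₄)
        (boolSign z₁) (boolSign z₂) (boolSign z₃) (boolSign z₄)) := by
  decide +kernel

/-- Every sign matrix is equivalent to one whose first row and first column consist of ones. -/
theorem exists_rectEquiv_bordered {A : Matrix (Fin 4) (Fin 5) ℚ}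
    (hA : ∀ i j, A i j = 1 ∨ A i j = -1) :
    ∃ b : Fin 4 → Fin 5 → Bool, RectEquiv A
      ((bordered (boolSign (b 1 1)) (boolSign (b 1 2)) (boolSign (b 1 3)) (boolSign (b 1 4))
        (boolSign (b 2 1)) (boolSign (b 2 2)) (boolSign (b 2 3)) (boolSign (b 2 4))
        (boolSign (b 3 1)) (boolSign (b 3 2)) (boolSign (b 3 3)) (boolSign (b 3 4))).map
          (Int.cast : ℤ → ℚ)) := by
  have hmul : ∀ {a c : ℚ}, (a = 1 ∨ a = -1) → (c = 1 ∨ c = -1) → (a * c = 1 ∨ a * c = -1) := by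
    rintro _ _ (rfl | rfl) (rfl | rfl) <;> simp
  have hsq : ∀ i j, A i j * A i j = 1 := fun i j => by rcases hA i j with h | h <;> simp [h]
  choose b hb using fun i j =>
    exists_boolSign_eq (hmul (hmul (hA 0 0) (hA i 0)) (hmul (hA 0 j) (hA i j)))
  refine ⟨b, Equiv.refl _, Equiv.refl _, fun i => A 0 0 * A i 0, fun j => A 0 j,
    fun i => hmul (hA 0 0) (hA i 0), fun j => hA 0 j, fun i j => ?_⟩
  have hN : A i j = A 0 0 * A i 0 * A 0 j * (A 0 0 * A i 0 * (A 0 j * A i j)) := by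
    linear_combination (-A i j) * hsq 0 0 - A 0 0 * A 0 0 * A i j * hsq i 0 -
      A 0 0 * A 0 0 * A i 0 * A i 0 * A i j * hsq 0 j
  refine hN.trans (congrArg _ ?_)
  fin_cases i
  · fin_cases j <;> simp [bordered] <;> grind
  all_goals
    fin_cases j
    · simp [bordered]; grind
    all_goals simp [bordered, hb]

theorem mper_bound_four_by_five (A : Matrix (Fin 4) (Fin 5) ℚ)
    (hA : ∀ i j, A i j = 1 ∨ A i j = -1) (hrk : A.rank = 4) :
    mper A ≤ mper (Dr 5 4 3) ∧ mper (Dr 5 4 3) = 32 ∧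
      (mper A = mper (Dr 5 4 3) ↔ RectEquiv A (Dr 5 4 3)) := by
  rw [mper_Dr]
  suffices h : mper A ≤ 24 ∨ mper A = 32 ∧ RectEquiv A (Dr 5 4 3) by
    refine ⟨?_, rfl, fun h32 => ?_, fun hD => hD.mper_eq.trans mper_Dr⟩
    · rcases h with h | h <;> linarith [h]
    · exact (h.resolve_left (by rw [h32]; norm_num)).2
  obtain ⟨b, hb⟩ := exists_rectEquiv_bordered hA
  rw [hb.mper_eq, mper_bordered]
  have hsign := fun i j => boolSign_eq (b i j)
  rcases smallOrExtremal_bordered (b 1 1) (b 1 2) (b 1 3) (b 1 4) (b 2 1) (b 2 2) (b 2 3) (b 2 4)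
    (b 3 1) (b 3 2) (b 3 3) (b 3 4) with h | ⟨i, i', hne, h⟩ | ⟨h, hpat⟩
  · exact .inl (by exact_mod_cast h)
  · refine absurd hrk (hb.rank_ne_of_row_eq hne fun j => ?_)
    rcases Int.mul_eq_one_iff_eq_one_or_neg_one.mp (h j) with h | h <;> simp [h]
  · refine .inr ⟨by exact_mod_cast h, hb.trans (hpat.rectEquiv fun i j => ?_)⟩
    fin_cases i <;> fin_cases j <;> simp [bordered, hsign]
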